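/- Let Ω ⊆ ℂⁿ be a bounded domain and let f, g ∈ ℳ. Then S(f + g) ≤ S f + S g everywhere on Ω. -/

import Mathlib

open Complex Polynomial Filter Set Topology

noncomputable section

/-- `u` is plurisubharmonic on `Ω ⊆ ℂⁿ`: it is upper semicontinuous on `Ω`, takes values in
`[-∞, ∞)`, is not identically `-∞`, and on every closed disc of every complex line contained
in `Ω` it satisfies the maximum principle against real parts of complex polynomials
(an equivalent formulation of subharmonicity of the restriction to every complex line). -/
def IsPSH {n : ℕ} (Ω : Set (Fin n → ℂ)) (u : (Fin n → ℂ) → EReal) : Prop :=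
  UpperSemicontinuousOn u Ω ∧
  (∀ z ∈ Ω, u z ≠ ⊤) ∧
  (∃ z ∈ Ω, u z ≠ ⊥) ∧
  ∀ z ∈ Ω, ∀ w : Fin n → ℂ, ∀ r : ℝ, 0 < r →
    (∀ ζ : ℂ, ‖ζ‖ ≤ r → z + ζ • w ∈ Ω) →
    ∀ p : Polynomial ℂ,
      (∀ ζ : ℂ, ‖ζ‖ = r → u (z + ζ • w) ≤ (((p.eval ζ).re : ℝ) : EReal)) →
      ∀ ζ : ℂ, ‖ζ‖ ≤ r → u (z + ζ • w) ≤ (((p.eval ζ).re : ℝ) : EReal)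

/-- `v` is plurisuperharmonic on `Ω` iff `-v` is plurisubharmonic on `Ω`. -/
def IsPSupH {n : ℕ} (Ω : Set (Fin n → ℂ)) (v : (Fin n → ℂ) → EReal) : Prop :=
  IsPSH Ω (fun z => -(v z))

/-- `f` belongs to the class `ℳ`: `f : Ω → [0, +∞]` admits a plurisuperharmonic
majorant on `Ω`. -/
def MemM {n : ℕ} (Ω : Set (Fin n → ℂ)) (f : (Fin n → ℂ) → EReal) : Prop :=
  (∀ z ∈ Ω, 0 ≤ f z) ∧ ∃ v, IsPSupH Ω v ∧ ∀ z ∈ Ω, f z ≤ v z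

/-- The reduced function `R_λ f`: the pointwise infimum of all plurisuperharmonic
majorants of `(f - λ)⁺ = max {f - λ, 0}` on `Ω`. -/
def Rop {n : ℕ} (Ω : Set (Fin n → ℂ)) (f : (Fin n → ℂ) → EReal) (lam : ℝ)
    (z : Fin n → ℂ) : EReal :=
  sInf { y | ∃ v, IsPSupH Ω v ∧ (∀ ζ ∈ Ω, max (f ζ - (lam : EReal)) 0 ≤ v ζ) ∧ y = v z }

/-- Lower semicontinuous regularization of `g` relative to the set `A`:
`g_*(z) = liminf_{A ∋ ζ → z} g(ζ)`. -/
def lscReg {n : ℕ} (A : Set (Fin n → ℂ)) (g : (Fin n → ℂ) → EReal)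
    (z : Fin n → ℂ) : EReal :=
  liminf g (nhdsWithin z A)

/-- Upper semicontinuous regularization of `g` relative to the set `A`:
`g*(z) = limsup_{A ∋ ζ → z} g(ζ)`. -/
def uscReg {n : ℕ} (A : Set (Fin n → ℂ)) (g : (Fin n → ℂ) → EReal)
    (z : Fin n → ℂ) : EReal :=
  limsup g (nhdsWithin z A)

/-- `S_λ f`: the lower semicontinuous regularization of `R_λ f` on `Ω`. -/
def Slam {n : ℕ} (Ω : Set (Fin n → ℂ)) (f : (Fin n → ℂ) → EReal) (lam : ℝ) :
    (Fin n → ℂ) → EReal :=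
  lscReg Ω (Rop Ω f lam)

/-- The operator `S`: the lower semicontinuous regularization of
`lim_{λ → ∞} S_λ f`; since `λ ↦ S_λ f` is decreasing on `λ ≥ 0`, this limit is the
infimum over `λ ≥ 0`. -/
def Sop {n : ℕ} (Ω : Set (Fin n → ℂ)) (f : (Fin n → ℂ) → EReal) :
    (Fin n → ℂ) → EReal :=
  lscReg Ω (fun z => ⨅ (lam : ℝ) (_ : 0 ≤ lam), Slam Ω f lam z)

/-- `f` is tame on `Ω` if `S f ≡ 0`. -/
def Tame {n : ℕ} (Ω : Set (Fin n → ℂ)) (f : (Fin n → ℂ) → EReal) : Prop :=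
  ∀ z ∈ Ω, Sop Ω f z = 0

/-- `E` is a pluripolar subset of `Ω`: `E ⊆ {w = -∞}` for some plurisubharmonic `w` on `Ω`. -/
def Pluripolar {n : ℕ} (Ω : Set (Fin n → ℂ)) (E : Set (Fin n → ℂ)) : Prop :=
  E ⊆ Ω ∧ ∃ w, IsPSH Ω w ∧ ∀ z ∈ E, w z = ⊥

open MeasureTheory
open scoped ENNReal

section LowerSemicontinuousApproximation

variable {X : Type*} [PseudoEMetricSpace X]

/-- Lipschitz inf-convolution of the truncation of `φ` at height `k`. -/
def lipApprox (φ : X → ℝ≥0∞) (k : ℕ) (x : X) : ℝ≥0∞ :=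
  ⨅ y, min (φ y) k + k * edist x y

lemma lipApprox_le_self (φ : X → ℝ≥0∞) (k : ℕ) (x : X) : lipApprox φ k x ≤ φ x :=
  (iInf_le _ x).trans (by simp)

lemma lipApprox_le_natCast (φ : X → ℝ≥0∞) (k : ℕ) (x : X) : lipApprox φ k x ≤ k :=
  (iInf_le _ x).trans (by simp)

lemma monotone_lipApprox (φ : X → ℝ≥0∞) : Monotone (lipApprox φ) := by
  intro k l hkl x
  refine iInf_mono fun y => ?_
  have : (k : ℝ≥0∞) ≤ l := by exact_mod_cast hkl
  gcongr

lemma continuous_lipApprox (φ : X → ℝ≥0∞) (k : ℕ) : Continuous (lipApprox φ k) := by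
  refine continuous_of_le_add_edist k (ENNReal.natCast_ne_top k) fun x y => ?_
  unfold lipApprox
  rw [ENNReal.iInf_add]
  refine iInf_mono fun w => ?_
  rw [add_assoc, ← mul_add]
  gcongr
  rw [add_comm]
  exact edist_triangle x y w

lemma iSup_lipApprox {φ : X → ℝ≥0∞} (hφ : LowerSemicontinuous φ) (x : X) :
    ⨆ k, lipApprox φ k x = φ x := by
  refine le_antisymm (iSup_le fun k => lipApprox_le_self φ k x) (le_of_forall_lt fun c hc => ?_)
  obtain ⟨c', hcc', hc'⟩ := exists_between hc
  obtain ⟨δ, hδ, hball⟩ := EMetric.mem_nhds_iff.1 (hφ x c' hc')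
  have hc'top : c' ≠ ⊤ := (hc'.trans_le le_top).ne
  obtain ⟨m, hm⟩ := ENNReal.exists_nat_gt hc'top
  obtain ⟨l, hl⟩ := ENNReal.exists_nat_mul_gt hδ.ne' hc'top
  refine hcc'.trans_le (le_iSup_of_le (max m l) (le_iInf fun y => ?_))
  by_cases hy : edist x y < δ
  · have h1 : c' ≤ φ y := (hball (show y ∈ _ by simpa [edist_comm] using hy)).le
    have h2 : c' ≤ (max m l : ℕ) := hm.le.trans (by exact_mod_cast le_max_left m l)
    exact (le_min h1 h2).trans le_self_add
  · have h3 : (l : ℝ≥0∞) ≤ (max m l : ℕ) := by exact_mod_cast le_max_right m l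
    calc c' ≤ l * δ := hl.le
      _ ≤ (max m l : ℕ) * edist x y := by gcongr; exact not_lt.1 hy
      _ ≤ _ := le_add_self

end LowerSemicontinuousApproximation

section TrigonometricPolynomials

/-- Every continuous function on the circle is uniformly approximated by functions of the form
`ζ ↦ p(ζ) + conj (q(ζ))` with polynomials `p`, `q`. -/
lemma exists_polynomial_re_near (h : C(UnitAddCircle, ℝ)) {ε : ℝ} (hε : 0 < ε) :
    ∃ p : Polynomial ℂ, ∀ x : UnitAddCircle,
      |(p.eval (AddCircle.toCircle x : ℂ)).re - h x| < ε := by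
  let hc : C(UnitAddCircle, ℂ) := ⟨fun x => (h x : ℂ), by fun_prop⟩
  have hmem : hc ∈ (Submodule.span ℂ (range (fourier (T := 1)))).topologicalClosure := by
    rw [span_fourier_closure_eq_top]; trivial
  obtain ⟨g, hg, hdist⟩ := Metric.mem_closure_iff.1 hmem ε hε
  have key : ∃ p q : Polynomial ℂ, ∀ x : UnitAddCircle,
      g x = p.eval (AddCircle.toCircle x : ℂ) +
        (starRingEnd ℂ) (q.eval (AddCircle.toCircle x : ℂ)) := by
    refine Submodule.span_induction (p := fun g _ => ∃ p q : Polynomial ℂ, ∀ x : UnitAddCircle,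
      g x = p.eval (AddCircle.toCircle x : ℂ) +
        (starRingEnd ℂ) (q.eval (AddCircle.toCircle x : ℂ))) ?_ ?_ ?_ ?_ hg
    · rintro _ ⟨k, rfl⟩
      obtain ⟨m, rfl | rfl⟩ := k.eq_nat_or_neg
      · exact ⟨Polynomial.X ^ m, 0, fun x => by simp [fourier_apply, AddCircle.toCircle_nsmul]⟩
      · refine ⟨0, Polynomial.X ^ m, fun x => ?_⟩
        rw [fourier_neg]
        simp [fourier_apply, AddCircle.toCircle_nsmul]
    · exact ⟨0, 0, fun x => by simp⟩
    · rintro a b _ _ ⟨p, q, hpq⟩ ⟨p', q', hpq'⟩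
      refine ⟨p + p', q + q', fun x => ?_⟩
      simp [hpq, hpq']; ring
    · rintro c a _ ⟨p, q, hpq⟩
      refine ⟨Polynomial.C c * p, Polynomial.C (starRingEnd ℂ c) * q, fun x => ?_⟩
      simp [hpq]; ring
  obtain ⟨p, q, hpq⟩ := key
  refine ⟨p + q, fun x => ?_⟩
  have h1 : ‖hc x - g x‖ < ε := by
    rw [← dist_eq_norm]; exact (ContinuousMap.dist_apply_le_dist x).trans_lt hdist
  have h2 := (Complex.abs_re_le_norm (hc x - g x)).trans_lt h1
  rw [abs_sub_comm]
  have h3 : (hc x - g x).re = h x - ((p + q).eval (AddCircle.toCircle x : ℂ)).re := by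
    rw [hpq]; simp [hc]
  rwa [← h3]

lemma integral_eval_toCircle (p : Polynomial ℂ) :
    ∫ x : UnitAddCircle, p.eval (AddCircle.toCircle x : ℂ) ∂AddCircle.haarAddCircle =
      p.eval 0 := by
  induction p using Polynomial.induction_on' with
  | add p q hp hq =>
    have hint (p : Polynomial ℂ) : Integrable
        (fun x : UnitAddCircle => p.eval (AddCircle.toCircle x : ℂ)) AddCircle.haarAddCircle := by
      refine Continuous.integrable_of_hasCompactSupport ?_ (HasCompactSupport.of_compactSpace _)
      have := AddCircle.continuous_toCircle (T := 1)
      fun_prop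
    simp only [Polynomial.eval_add]
    rw [integral_add (hint p) (hint q), hp, hq]
  | monomial n a =>
    rcases eq_or_ne n 0 with rfl | hn
    · simp
    · have hz : ∫ x : UnitAddCircle, (fourier (n : ℤ) x : ℂ) ∂AddCircle.haarAddCircle = 0 :=
        integral_eq_zero_of_add_right_eq_neg (μ := AddCircle.haarAddCircle)
          (fourier_add_half_inv_index (by exact_mod_cast hn) (by norm_num))
      have : ∀ x : UnitAddCircle, (Polynomial.monomial n a).eval (AddCircle.toCircle x : ℂ) =
          a * fourier (n : ℤ) x := fun x => by
        simp [fourier_apply, AddCircle.toCircle_nsmul]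
      simp_rw [this]
      rw [integral_const_mul, hz]
      simp [hn]

/-- The maximum principle for real parts of polynomials on the unit disc. -/
lemma polynomial_re_le_of_circle {p q : Polynomial ℂ} {ε : ℝ}
    (h : ∀ ζ : ℂ, ‖ζ‖ = 1 → (p.eval ζ).re ≤ (q.eval ζ).re + ε) {ζ : ℂ} (hζ : ‖ζ‖ ≤ 1) :
    (p.eval ζ).re ≤ (q.eval ζ).re + ε := by
  have hd : DiffContOnCl ℂ (fun z => Complex.exp (p.eval z - q.eval z)) (Metric.ball 0 1) :=
    Differentiable.diffContOnCl (by fun_prop)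
  have := Complex.norm_le_of_forall_mem_frontier_norm_le Metric.isBounded_ball hd
    (C := Real.exp ε) (fun z hz => ?_) (z := ζ) ?_
  · rw [Complex.norm_exp, Real.exp_le_exp] at this
    simp at this; linarith
  · rw [frontier_ball _ one_ne_zero] at hz
    have := h z (by simpa using hz)
    rw [Complex.norm_exp, Real.exp_le_exp]
    simp; linarith
  · rw [closure_ball _ one_ne_zero]; simpa using hζ

end TrigonometricPolynomials

section DiscMinimumPrinciple

/-- A function on the closed unit disc which is nonnegative, lower semicontinuous on the unit
circle, and satisfies the minimum principle against real parts of polynomials. -/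
structure DiscSuper (ψ : ℂ → EReal) : Prop where
  nonneg : ∀ ζ : ℂ, ‖ζ‖ ≤ 1 → 0 ≤ ψ ζ
  lsc : LowerSemicontinuous fun x : UnitAddCircle => (ψ (AddCircle.toCircle x)).toENNReal
  min_principle : ∀ p : Polynomial ℂ,
    (∀ ζ : ℂ, ‖ζ‖ = 1 → (((p.eval ζ).re : ℝ) : EReal) ≤ ψ ζ) →
      ∀ ζ : ℂ, ‖ζ‖ ≤ 1 → (((p.eval ζ).re : ℝ) : EReal) ≤ ψ ζ

lemma exists_toCircle_eq {ζ : ℂ} (hζ : ‖ζ‖ = 1) :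
    ∃ x : UnitAddCircle, (AddCircle.toCircle x : ℂ) = ζ := by
  obtain ⟨x, hx⟩ := (AddCircle.homeomorphCircle (T := 1) one_ne_zero).surjective
    ⟨ζ, mem_sphere_zero_iff_norm.2 hζ⟩
  refine ⟨x, ?_⟩
  rw [AddCircle.homeomorphCircle_apply] at hx
  rw [hx]

namespace DiscSuper

variable {ψ ψ₁ ψ₂ : ℂ → EReal}

/-- Boundary values of `ψ`, as an extended nonnegative function on the circle. -/
def boundary (ψ : ℂ → EReal) (x : UnitAddCircle) : ℝ≥0∞ := (ψ (AddCircle.toCircle x)).toENNReal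

/-- Real-valued continuous approximations from below of the boundary values of `ψ`. -/
def approx (ψ : ℂ → EReal) (k : ℕ) : C(UnitAddCircle, ℝ) where
  toFun x := (lipApprox (boundary ψ) k x).toReal
  continuous_toFun := ENNReal.continuousOn_toReal.comp_continuous (continuous_lipApprox _ k)
    fun x => ((lipApprox_le_natCast _ k x).trans_lt (ENNReal.natCast_lt_top k)).ne

lemma approx_nonneg (ψ : ℂ → EReal) (k : ℕ) (x : UnitAddCircle) : 0 ≤ approx ψ k x :=
  ENNReal.toReal_nonneg

lemma ofReal_approx (ψ : ℂ → EReal) (k : ℕ) (x : UnitAddCircle) :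
    ENNReal.ofReal (approx ψ k x) = lipApprox (boundary ψ) k x :=
  ENNReal.ofReal_toReal ((lipApprox_le_natCast _ k x).trans_lt (ENNReal.natCast_lt_top k)).ne

lemma approx_mono (ψ : ℂ → EReal) (x : UnitAddCircle) : Monotone fun k => approx ψ k x := by
  intro k l hkl
  refine ENNReal.toReal_mono ?_ (monotone_lipApprox _ hkl x)
  exact ((lipApprox_le_natCast _ l x).trans_lt (ENNReal.natCast_lt_top l)).ne

lemma approx_le (hψ : DiscSuper ψ) (k : ℕ) (x : UnitAddCircle) :
    (approx ψ k x : EReal) ≤ ψ (AddCircle.toCircle x) := by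
  have h0 : 0 ≤ ψ (AddCircle.toCircle x) := hψ.nonneg _ (Circle.norm_coe _).le
  rw [← EReal.coe_toENNReal h0, ← max_eq_left (approx_nonneg ψ k x), ← EReal.coe_ennreal_ofReal,
    ofReal_approx]
  exact_mod_cast lipApprox_le_self _ k x

lemma exists_polynomial_le (hψ : DiscSuper ψ) (k : ℕ) {ε : ℝ} (hε : 0 < ε) :
    ∃ p : Polynomial ℂ, (∀ ζ : ℂ, ‖ζ‖ ≤ 1 → (((p.eval ζ).re : ℝ) : EReal) ≤ ψ ζ) ∧
      ∀ x : UnitAddCircle, approx ψ k x ≤ (p.eval (AddCircle.toCircle x : ℂ)).re + ε := by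
  obtain ⟨p, hp⟩ := exists_polynomial_re_near (approx ψ k - ContinuousMap.const _ (ε / 2))
    (half_pos hε)
  simp only [ContinuousMap.sub_apply, ContinuousMap.const_apply, abs_lt] at hp
  refine ⟨p, hψ.min_principle p fun ζ hζ => ?_, fun x => by linarith [(hp x).1]⟩
  obtain ⟨x, rfl⟩ := exists_toCircle_eq hζ
  refine le_trans ?_ (hψ.approx_le k x)
  exact_mod_cast (by linarith [(hp x).2] : (p.eval (AddCircle.toCircle x : ℂ)).re ≤ approx ψ k x)

/-- The super mean value property over the unit circle. -/
lemma lintegral_le (hψ : DiscSuper ψ) :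
    ∫⁻ x : UnitAddCircle, (ψ (AddCircle.toCircle x)).toENNReal ∂AddCircle.haarAddCircle ≤
      (ψ 0).toENNReal := by
  have hint (h : UnitAddCircle → ℝ) (hh : Continuous h) :
      Integrable h AddCircle.haarAddCircle :=
    hh.integrable_of_hasCompactSupport (HasCompactSupport.of_compactSpace _)
  have h1 : ∀ x : UnitAddCircle, (ψ (AddCircle.toCircle x)).toENNReal =
      ⨆ k, lipApprox (boundary ψ) k x := fun x => (iSup_lipApprox hψ.lsc x).symm
  simp_rw [h1]
  rw [lintegral_iSup (fun k => (continuous_lipApprox _ k).measurable) (monotone_lipApprox _)]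
  refine iSup_le fun k => ?_
  simp_rw [← ofReal_approx]
  rw [← ofReal_integral_eq_lintegral_ofReal (hint _ (approx ψ k).continuous)
    (Eventually.of_forall (approx_nonneg ψ k))]
  refine ENNReal.le_of_forall_pos_le_add fun ε hε _ => ?_
  obtain ⟨p, hp, hpε⟩ := hψ.exists_polynomial_le k (ε := ε) hε
  have hcont : Continuous fun x : UnitAddCircle => p.eval (AddCircle.toCircle x : ℂ) := by
    have := AddCircle.continuous_toCircle (T := 1)
    fun_prop
  have h2 : ∫ x, approx ψ k x ∂AddCircle.haarAddCircle ≤ (p.eval 0).re + ε := by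
    calc ∫ x, approx ψ k x ∂AddCircle.haarAddCircle
        ≤ ∫ x : UnitAddCircle, ((p.eval (AddCircle.toCircle x : ℂ)).re + ε)
            ∂AddCircle.haarAddCircle :=
          integral_mono (hint _ (approx ψ k).continuous)
            (hint _ ((Complex.continuous_re.comp hcont).add continuous_const)) hpε
      _ = (p.eval 0).re + ε := by
          rw [integral_add (f := fun x : UnitAddCircle => (p.eval (AddCircle.toCircle x : ℂ)).re)
            (hint _ (Complex.continuous_re.comp hcont)) (integrable_const _),
            ← integral_eval_toCircle p]
          congr 1
          · exact integral_re (𝕜 := ℂ) (hcont.integrable_of_hasCompactSupport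
              (HasCompactSupport.of_compactSpace _))
          · simp
  calc ENNReal.ofReal (∫ x, approx ψ k x ∂AddCircle.haarAddCircle)
      ≤ ENNReal.ofReal ((p.eval 0).re + ε) := ENNReal.ofReal_le_ofReal h2
    _ ≤ ENNReal.ofReal (p.eval 0).re + ENNReal.ofReal ε := ENNReal.ofReal_add_le
    _ ≤ (ψ 0).toENNReal + ε := by
        gcongr
        · rw [← EReal.real_coe_toENNReal]
          exact EReal.toENNReal_le_toENNReal (hp 0 (by simp))
        · simp

lemma exists_approx_add_gt (h₁ : DiscSuper ψ₁) (h₂ : DiscSuper ψ₂) {p : Polynomial ℂ}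
    (hp : ∀ ζ : ℂ, ‖ζ‖ = 1 → (((p.eval ζ).re : ℝ) : EReal) ≤ ψ₁ ζ + ψ₂ ζ) {ε : ℝ} (hε : 0 < ε) :
    ∃ k, ∀ x : UnitAddCircle, (p.eval (AddCircle.toCircle x : ℂ)).re - ε <
      approx ψ₁ k x + approx ψ₂ k x := by
  have hcont : Continuous fun x : UnitAddCircle => (p.eval (AddCircle.toCircle x : ℂ)).re := by
    have := AddCircle.continuous_toCircle (T := 1)
    fun_prop
  let U : ℕ → Set UnitAddCircle := fun k =>
    {x | (p.eval (AddCircle.toCircle x : ℂ)).re - ε < approx ψ₁ k x + approx ψ₂ k x}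
  have hmono : Monotone U := fun k l hkl x hx =>
    lt_of_lt_of_le hx (add_le_add (approx_mono ψ₁ x hkl) (approx_mono ψ₂ x hkl))
  suffices hcover : ∀ x, ∃ k, x ∈ U k by
    obtain ⟨k, hk⟩ := isCompact_univ.elim_directed_cover U
      (fun k => isOpen_lt (hcont.sub continuous_const)
        ((approx ψ₁ k).continuous.add (approx ψ₂ k).continuous))
      (fun x _ => mem_iUnion.2 (hcover x)) hmono.directed_le
    exact ⟨k, fun x => hk (mem_univ x)⟩
  intro x
  set c := (p.eval (AddCircle.toCircle x : ℂ)).re - ε with hc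
  rcases lt_or_ge c 0 with hneg | hnn
  · exact ⟨0, hneg.trans_le (add_nonneg (approx_nonneg _ _ _) (approx_nonneg _ _ _))⟩
  have hlt : ENNReal.ofReal c < boundary ψ₁ x + boundary ψ₂ x := by
    calc ENNReal.ofReal c < ENNReal.ofReal (c + ε) :=
          (ENNReal.ofReal_lt_ofReal_iff (by linarith)).2 (by linarith)
      _ = (((p.eval (AddCircle.toCircle x : ℂ)).re : ℝ) : EReal).toENNReal := by
          simp [hc]
      _ ≤ (ψ₁ (AddCircle.toCircle x) + ψ₂ (AddCircle.toCircle x)).toENNReal :=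
          EReal.toENNReal_le_toENNReal (hp _ (Circle.norm_coe _))
      _ = _ := EReal.toENNReal_add (h₁.nonneg _ (Circle.norm_coe _).le) (h₂.nonneg _ (Circle.norm_coe _).le)
  have ht : Tendsto (fun k => lipApprox (boundary ψ₁) k x + lipApprox (boundary ψ₂) k x) atTop
      (𝓝 (boundary ψ₁ x + boundary ψ₂ x)) := by
    refine Tendsto.add ?_ ?_
    · have := tendsto_atTop_iSup (fun k l hkl => monotone_lipApprox (boundary ψ₁) hkl x)
      rwa [iSup_lipApprox (φ := boundary ψ₁) h₁.lsc x] at this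
    · have := tendsto_atTop_iSup (fun k l hkl => monotone_lipApprox (boundary ψ₂) hkl x)
      rwa [iSup_lipApprox (φ := boundary ψ₂) h₂.lsc x] at this
  obtain ⟨k, hk⟩ := (ht.eventually (lt_mem_nhds hlt)).exists
  refine ⟨k, ?_⟩
  rw [← ofReal_approx, ← ofReal_approx,
    ← ENNReal.ofReal_add (approx_nonneg _ _ _) (approx_nonneg _ _ _)] at hk
  exact (ENNReal.ofReal_lt_ofReal_iff_of_nonneg hnn).1 hk

lemma add_min_principle (h₁ : DiscSuper ψ₁) (h₂ : DiscSuper ψ₂) (p : Polynomial ℂ)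
    (hp : ∀ ζ : ℂ, ‖ζ‖ = 1 → (((p.eval ζ).re : ℝ) : EReal) ≤ ψ₁ ζ + ψ₂ ζ) (ζ : ℂ)
    (hζ : ‖ζ‖ ≤ 1) : (((p.eval ζ).re : ℝ) : EReal) ≤ ψ₁ ζ + ψ₂ ζ := by
  have key : ∀ ε : ℝ, 0 < ε →
      ∃ a b : ℝ, (a : EReal) ≤ ψ₁ ζ ∧ (b : EReal) ≤ ψ₂ ζ ∧ (p.eval ζ).re ≤ a + b + ε := by
    intro ε hε
    obtain ⟨k, hk⟩ := exists_approx_add_gt h₁ h₂ hp (ε := ε / 3) (by linarith)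
    obtain ⟨p₁, hp₁, hpk₁⟩ := h₁.exists_polynomial_le k (ε := ε / 3) (by linarith)
    obtain ⟨p₂, hp₂, hpk₂⟩ := h₂.exists_polynomial_le k (ε := ε / 3) (by linarith)
    refine ⟨_, _, hp₁ ζ hζ, hp₂ ζ hζ, ?_⟩
    have := polynomial_re_le_of_circle (p := p) (q := p₁ + p₂) (ε := ε) (fun ξ hξ => ?_) hζ
    · simpa only [Polynomial.eval_add, Complex.add_re] using this
    · obtain ⟨x, rfl⟩ := exists_toCircle_eq hξ
      simp only [Polynomial.eval_add, Complex.add_re]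
      linarith [hk x, hpk₁ x, hpk₂ x]
  have n₁ := h₁.nonneg ζ hζ
  have n₂ := h₂.nonneg ζ hζ
  generalize ψ₁ ζ = s at *
  generalize ψ₂ ζ = t at *
  induction s with
  | bot => simp at n₁
  | top => rw [EReal.top_add_of_ne_bot (EReal.bot_lt_zero.trans_le n₂).ne']; exact le_top
  | coe s =>
    induction t with
    | bot => simp at n₂
    | top => simp
    | coe t =>
      have : (p.eval ζ).re ≤ s + t := le_of_forall_pos_le_add fun ε hε => by
        obtain ⟨a, b, ha, hb, hab⟩ := key ε hε
        have := EReal.coe_le_coe_iff.1 ha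
        have := EReal.coe_le_coe_iff.1 hb
        linarith
      exact_mod_cast this

end DiscSuper

end DiscMinimumPrinciple

section SuperMean

variable {n : ℕ} {Ω : Set (Fin n → ℂ)}

/-- The extended nonnegative version of `v`, extended by zero outside `Ω`. -/
def toENNRealOn (Ω : Set (Fin n → ℂ)) (v : (Fin n → ℂ) → EReal) : (Fin n → ℂ) → ℝ≥0∞ :=
  Ω.indicator fun z => (v z).toENNReal

lemma toENNRealOn_apply {v : (Fin n → ℂ) → EReal} {z : Fin n → ℂ} (hz : z ∈ Ω) :
    toENNRealOn Ω v z = (v z).toENNReal := indicator_of_mem hz _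

lemma IsPSupH.lowerSemicontinuous_toENNRealOn (hΩ : IsOpen Ω) {v : (Fin n → ℂ) → EReal}
    (hv : IsPSupH Ω v) : LowerSemicontinuous (toENNRealOn Ω v) := by
  intro z c hc
  by_cases hz : z ∈ Ω
  · rw [toENNRealOn_apply hz] at hc
    have hpos : 0 ≤ v z := by
      by_contra hneg
      rw [EReal.toENNReal_of_nonpos (not_le.1 hneg).le] at hc
      exact not_lt_bot hc
    have h1 : (c : EReal) < v z := by
      rw [← EReal.coe_toENNReal hpos]; exact_mod_cast hc
    have h2 := hv.1 z hz (-(c : EReal)) (EReal.neg_lt_neg_iff.2 h1)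
    rw [hΩ.nhdsWithin_eq hz] at h2
    filter_upwards [h2, hΩ.mem_nhds hz] with y hy hyΩ
    rw [toENNRealOn_apply hyΩ, ← EReal.toENNReal_coe (x := c)]
    exact EReal.toENNReal_lt_toENNReal (EReal.coe_ennreal_nonneg c) (EReal.neg_lt_neg_iff.1 hy)
  · simp [toENNRealOn, hz] at hc

lemma IsPSupH.discSuper (hΩ : IsOpen Ω) {v : (Fin n → ℂ) → EReal} (hv : IsPSupH Ω v)
    (h0 : ∀ z ∈ Ω, 0 ≤ v z) {z w : Fin n → ℂ} (hd : ∀ ζ : ℂ, ‖ζ‖ ≤ 1 → z + ζ • w ∈ Ω) :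
    DiscSuper fun ζ => v (z + ζ • w) where
  nonneg ζ hζ := h0 _ (hd ζ hζ)
  lsc := by
    have hc : Continuous fun x : UnitAddCircle => z + (AddCircle.toCircle x : ℂ) • w := by
      have := AddCircle.continuous_toCircle (T := 1)
      fun_prop
    have := LowerSemicontinuous.comp (hv.lowerSemicontinuous_toENNRealOn hΩ) hc
    refine cast (congrArg LowerSemicontinuous (funext fun x => ?_)) this
    exact toENNRealOn_apply (hd _ (Circle.norm_coe _).le)
  min_principle p hp ζ hζ := by
    have hz : z ∈ Ω := by simpa using hd 0 (by simp)
    have := hv.2.2.2 z hz w 1 one_pos hd (-p) (fun ξ hξ => ?_) ζ hζ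
    · simpa [EReal.neg_le_neg_iff] using this
    · simpa [EReal.neg_le_neg_iff] using hp ξ hξ

/-- A relaxed super mean value inequality over polydiscs, comparing the integral over a polydisc
with the value at the center times the volume of any larger polydisc contained in `Ω`. -/
def SuperMean (Ω : Set (Fin n → ℂ)) (V : (Fin n → ℂ) → ℝ≥0∞) : Prop :=
  ∀ z : Fin n → ℂ, ∀ s r : ℝ, 0 < s → s < r → Metric.closedBall z r ⊆ Ω →
    ∫⁻ x in Metric.ball z s, V x ≤ volume (Metric.ball z r) * V z

lemma measurePreserving_circle_smul (t : Circle) :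
    MeasurePreserving (fun x : Fin n → ℂ => (t : ℂ) • x) := by
  refine volume_preserving_pi (f := fun _ (c : ℂ) => (t : ℂ) • c) fun _ => ?_
  exact (rotation t).measurePreserving

lemma setLIntegral_ball_circle_smul (V : (Fin n → ℂ) → ℝ≥0∞) (hV : Measurable V)
    (z : Fin n → ℂ) (s : ℝ) (t : Circle) :
    ∫⁻ x in Metric.ball z s, V x = ∫⁻ x in Metric.ball 0 s, V (z + (t : ℂ) • x) := by
  have hmp := (measurePreserving_add_left (volume : Measure (Fin n → ℂ)) z).comp
    (measurePreserving_circle_smul (n := n) t)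
  rw [← hmp.setLIntegral_comp_preimage Metric.isOpen_ball.measurableSet hV]
  congr 2
  ext x
  simp [norm_smul, Circle.norm_coe t]

lemma IsPSupH.superMean (hΩ : IsOpen Ω) {v : (Fin n → ℂ) → EReal} (hv : IsPSupH Ω v)
    (h0 : ∀ z ∈ Ω, 0 ≤ v z) : SuperMean Ω (toENNRealOn Ω v) := by
  intro z s r hs hsr hball
  have hlsc := hv.lowerSemicontinuous_toENNRealOn hΩ
  set V := toENNRealOn Ω v with hVdef
  have hmeas : Measurable V := hlsc.measurable
  have hc : Continuous fun q : UnitAddCircle × (Fin n → ℂ) =>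
      z + (AddCircle.toCircle q.1 : ℂ) • q.2 := by
    have := AddCircle.continuous_toCircle (T := 1)
    fun_prop
  calc ∫⁻ x in Metric.ball z s, V x
      = ∫⁻ _ : UnitAddCircle, (∫⁻ x in Metric.ball z s, V x) ∂AddCircle.haarAddCircle := by simp
    _ = ∫⁻ t : UnitAddCircle, (∫⁻ x in Metric.ball 0 s, V (z + (AddCircle.toCircle t : ℂ) • x))
          ∂AddCircle.haarAddCircle :=
        lintegral_congr fun t => setLIntegral_ball_circle_smul V hmeas z s _
    _ = ∫⁻ x in Metric.ball 0 s, (∫⁻ t : UnitAddCircle, V (z + (AddCircle.toCircle t : ℂ) • x)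
          ∂AddCircle.haarAddCircle) :=
        lintegral_lintegral_swap (hmeas.comp hc.measurable).aemeasurable
    _ ≤ ∫⁻ x in Metric.ball (0 : Fin n → ℂ) s, V z := by
        refine setLIntegral_mono measurable_const fun x hx => ?_
        have hd : ∀ ζ : ℂ, ‖ζ‖ ≤ 1 → z + ζ • x ∈ Ω := fun ζ hζ => hball (by
          have hx' : ‖x‖ < s := by simpa using hx
          have : ‖ζ‖ * ‖x‖ ≤ 1 * ‖x‖ := by gcongr
          simp only [Metric.mem_closedBall, dist_self_add_left, norm_smul]
          linarith)
        have := (hv.discSuper hΩ h0 hd).lintegral_le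
        have hz : z ∈ Ω := by simpa using hd 0 (by simp)
        have e : ∀ t : UnitAddCircle, V (z + (AddCircle.toCircle t : ℂ) • x) =
            (v (z + (AddCircle.toCircle t : ℂ) • x)).toENNReal := fun t =>
          toENNRealOn_apply (hd _ (Circle.norm_coe _).le)
        simp_rw [e, hVdef, toENNRealOn_apply hz]
        simpa using this
    _ = volume (Metric.ball z s) * V z := by
        rw [setLIntegral_const, mul_comm, Measure.addHaar_ball_center volume z]
    _ ≤ _ := by gcongr

lemma ae_lt_top_of_superMean {V : (Fin n → ℂ) → ℝ≥0∞} (hV : Measurable V)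
    (hm : SuperMean Ω V) {z : Fin n → ℂ} {s r : ℝ} (hs : 0 < s) (hsr : s < r)
    (hball : Metric.closedBall z r ⊆ Ω) (hz : V z ≠ ⊤) :
    ∀ᵐ x, x ∈ Metric.ball z s → V x < ⊤ := by
  have h := (hm z s r hs hsr hball).trans_lt
    (ENNReal.mul_lt_top measure_ball_lt_top hz.lt_top)
  have := ae_lt_top hV h.ne
  exact (ae_restrict_iff' Metric.isOpen_ball.measurableSet).1 this

/-- On a connected open set, a function with the super mean value property which is finite at one
point is finite almost everywhere in a neighbourhood of every point. -/
lemma exists_ball_ae_lt_top (hΩ : IsOpen Ω) (hc : IsConnected Ω) {V : (Fin n → ℂ) → ℝ≥0∞}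
    (hV : Measurable V) (hm : SuperMean Ω V) (hfin : ∃ z ∈ Ω, V z ≠ ⊤) {z : Fin n → ℂ}
    (hz : z ∈ Ω) : ∃ s > 0, ∀ᵐ x, x ∈ Metric.ball z s → V x < ⊤ := by
  let U : Set (Fin n → ℂ) := {z | ∃ s > 0, ∀ᵐ x, x ∈ Metric.ball z s → V x < ⊤}
  have hUo : IsOpen U := by
    rw [Metric.isOpen_iff]
    rintro y ⟨s, hs, h⟩
    refine ⟨s / 2, by positivity, fun y' hy' => ⟨s / 2, by positivity, ?_⟩⟩
    filter_upwards [h] with x hx hxy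
    refine hx (Metric.mem_ball.2 ?_)
    have := dist_triangle x y' y
    rw [Metric.mem_ball] at hy' hxy
    linarith
  have hsub : Ω ⊆ U := by
    refine hc.isPreconnected.subset_of_closure_inter_subset hUo ?_ ?_
    · obtain ⟨y, hy, hyV⟩ := hfin
      obtain ⟨r, hr, hball⟩ := Metric.nhds_basis_closedBall.mem_iff.1 (hΩ.mem_nhds hy)
      exact ⟨y, hy, r / 2, by positivity,
        ae_lt_top_of_superMean hV hm (by positivity) (by linarith) hball hyV⟩
    · rintro y ⟨hycl, hy⟩
      obtain ⟨r, hr, hball⟩ := Metric.nhds_basis_closedBall.mem_iff.1 (hΩ.mem_nhds hy)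
      obtain ⟨y', ⟨s, hs, hy's⟩, hyy'⟩ := Metric.mem_closure_iff.1 hycl (r / 8) (by positivity)
      have hpos : volume (Metric.ball y' (min s (r / 8))) ≠ 0 :=
        (Metric.measure_ball_pos volume y' (by positivity)).ne'
      obtain ⟨p, hp, hpV⟩ : ∃ p ∈ Metric.ball y' (min s (r / 8)), V p < ⊤ := by
        by_contra! hcon
        refine hpos (measure_mono_null (fun p hp => ?_) hy's)
        have hps := Metric.ball_subset_ball (min_le_left _ _) hp
        exact fun h => absurd (h hps) (not_lt.2 (hcon p hp))
      have hpr : dist p y' < r / 8 := Metric.ball_subset_ball (min_le_right _ _) hp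
      have hpy : dist p y < r / 4 := by
        have := dist_triangle p y' y
        rw [dist_comm] at hyy'
        linarith
      refine ⟨r / 4, by positivity, ?_⟩
      have hpb : Metric.closedBall p (3 * r / 4) ⊆ Ω := fun x hx => hball (by
        have := dist_triangle x p y
        rw [Metric.mem_closedBall] at hx ⊢
        linarith)
      filter_upwards [ae_lt_top_of_superMean hV hm (s := r / 2) (by positivity) (by linarith)
        hpb hpV.ne] with x hx hxy
      refine hx (Metric.mem_ball.2 ?_)
      have := dist_triangle x y p
      rw [dist_comm y p] at this
      rw [Metric.mem_ball] at hxy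
      linarith
  exact hsub hz

lemma IsPSupH.add (hΩ : IsOpen Ω) (hc : IsConnected Ω) {v u : (Fin n → ℂ) → EReal}
    (hv : IsPSupH Ω v) (hu : IsPSupH Ω u) (hv0 : ∀ z ∈ Ω, 0 ≤ v z) (hu0 : ∀ z ∈ Ω, 0 ≤ u z) :
    IsPSupH Ω fun z => v z + u z := by
  have hbot {x : EReal} (hx : 0 ≤ x) : x ≠ ⊥ := (EReal.bot_lt_zero.trans_le hx).ne'
  refine ⟨?_, fun z hz => ?_, ?_, ?_⟩
  · have hadd := UpperSemicontinuousOn.add' hv.1 hu.1 fun z hz => EReal.continuousAt_add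
      (.inl (by simp [hbot (hv0 z hz)])) (.inr (by simp [hbot (hu0 z hz)]))
    have e : ∀ z ∈ Ω, -(v z + u z) = -v z + -u z := fun z hz =>
      EReal.neg_add (.inl (hbot (hv0 z hz))) (.inr (hbot (hu0 z hz)))
    intro z hz c hc
    filter_upwards [hadd z hz c ((e z hz).symm.trans_lt hc), self_mem_nhdsWithin] with x hx hxΩ
    exact (e x hxΩ).trans_lt hx
  · rw [Ne, EReal.neg_eq_top_iff]
    exact hbot (add_nonneg (hv0 z hz) (hu0 z hz))
  · have hfin {v : (Fin n → ℂ) → EReal} (hv : IsPSupH Ω v) : ∃ z ∈ Ω, toENNRealOn Ω v z ≠ ⊤ := by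
      obtain ⟨z, hz, h⟩ := hv.2.2.1
      refine ⟨z, hz, ?_⟩
      rw [toENNRealOn_apply hz, EReal.toENNReal_ne_top_iff]
      rintro h'
      simp [h'] at h
    obtain ⟨z, hz⟩ := hc.nonempty
    obtain ⟨s, hs, hvs⟩ := exists_ball_ae_lt_top hΩ hc
      (hv.lowerSemicontinuous_toENNRealOn hΩ).measurable (hv.superMean hΩ hv0) (hfin hv) hz
    obtain ⟨t, ht, hut⟩ := exists_ball_ae_lt_top hΩ hc
      (hu.lowerSemicontinuous_toENNRealOn hΩ).measurable (hu.superMean hΩ hu0) (hfin hu) hz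
    have hopen : IsOpen (Ω ∩ Metric.ball z (min s t)) := hΩ.inter Metric.isOpen_ball
    have hpos : volume (Ω ∩ Metric.ball z (min s t)) ≠ 0 :=
      (hopen.measure_pos volume ⟨z, hz, Metric.mem_ball_self (lt_min hs ht)⟩).ne'
    by_contra! hcon
    refine hpos (measure_mono_null (fun p hp => ?_) (hvs.and hut))
    rintro ⟨h1, h2⟩
    have h1 := h1 (Metric.ball_subset_ball (min_le_left _ _) hp.2)
    have h2 := h2 (Metric.ball_subset_ball (min_le_right _ _) hp.2)
    rw [toENNRealOn_apply hp.1] at h1 h2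
    have h3 := hcon p hp.1
    rw [EReal.neg_eq_bot_iff] at h3
    exact EReal.add_ne_top (EReal.toENNReal_ne_top_iff.1 h1.ne)
      (EReal.toENNReal_ne_top_iff.1 h2.ne) h3
  · intro z hz w r hr hd p hp ζ hζ
    have hd' : ∀ ξ : ℂ, ‖ξ‖ ≤ 1 → z + ξ • ((r : ℂ) • w) ∈ Ω := fun ξ hξ => by
      rw [smul_smul]
      refine hd _ ?_
      rw [norm_mul, Complex.norm_real, Real.norm_of_nonneg hr.le]
      nlinarith
    have hr' : (r : ℂ) ≠ 0 := by exact_mod_cast hr.ne'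
    have := DiscSuper.add_min_principle (hv.discSuper hΩ hv0 hd') (hu.discSuper hΩ hu0 hd')
      (-(p.comp (Polynomial.C (r : ℂ) * Polynomial.X))) (fun ξ hξ => ?_) (ζ / r) ?_
    · rw [EReal.neg_le]
      have e : ζ / (r : ℂ) * r = ζ := div_mul_cancel₀ _ hr'
      have e' : (r : ℂ) * (ζ / r) = ζ := by rw [mul_comm, e]
      simpa only [smul_smul, e, Polynomial.eval_neg, Polynomial.eval_comp, Polynomial.eval_mul,
        Polynomial.eval_C, Polynomial.eval_X, e', Complex.neg_re, EReal.coe_neg] using this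
    · have := hp (r * ξ) (by simp [hξ, abs_of_pos hr])
      rw [EReal.neg_le] at this
      simpa only [smul_smul, mul_comm ξ, Polynomial.eval_neg, Polynomial.eval_comp,
        Polynomial.eval_mul, Polynomial.eval_C, Polynomial.eval_X, Complex.neg_re,
        EReal.coe_neg] using this
    · rw [norm_div, Complex.norm_real, Real.norm_of_nonneg hr.le]
      exact div_le_one_of_le₀ hζ hr.le

end SuperMean

section Regularization

variable {n : ℕ} {Ω : Set (Fin n → ℂ)}

/-- Lower semicontinuous regularization of an extended nonnegative function. -/
def lscHull (a : (Fin n → ℂ) → ℝ≥0∞) (z : Fin n → ℂ) : ℝ≥0∞ := liminf a (𝓝 z)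

/-- The lower semicontinuous regularization of the lower envelope of a family. -/
def regInf (F : Set ((Fin n → ℂ) → ℝ≥0∞)) : (Fin n → ℂ) → ℝ≥0∞ :=
  lscHull fun z => ⨅ V ∈ F, V z

lemma lscHull_le (a : (Fin n → ℂ) → ℝ≥0∞) (z : Fin n → ℂ) : lscHull a z ≤ a z :=
  le_of_forall_lt fun _ hc => (eventually_lt_of_lt_liminf hc).self_of_nhds

lemma lowerSemicontinuous_lscHull (a : (Fin n → ℂ) → ℝ≥0∞) :
    LowerSemicontinuous (lscHull a) := by
  intro z c hc
  obtain ⟨c', hcc', hc'⟩ := exists_between hc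
  filter_upwards [(eventually_lt_of_lt_liminf hc').eventually_nhds] with y hy
  exact hcc'.trans_le (le_liminf_of_le (h := hy.mono fun _ h => h.le))

lemma regInf_le {F : Set ((Fin n → ℂ) → ℝ≥0∞)} {V : (Fin n → ℂ) → ℝ≥0∞} (hV : V ∈ F)
    (z : Fin n → ℂ) : regInf F z ≤ V z :=
  (lscHull_le _ z).trans (iInf₂_le V hV)

lemma iInf_lintegral_le_regInf {F : Set ((Fin n → ℂ) → ℝ≥0∞)} (hF : ∀ V ∈ F, SuperMean Ω V)
    {z : Fin n → ℂ} {s r : ℝ} (hs : 0 < s) (hsr : s < r) (hball : Metric.closedBall z r ⊆ Ω) :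
    ⨅ V ∈ F, ∫⁻ x in Metric.ball z s, V x ≤ volume (Metric.ball z r) * regInf F z := by
  have hr : 0 < r := hs.trans hsr
  have hδ : 0 < (r - s) / 3 := by linarith
  refine (ENNReal.div_le_iff_le_mul (.inl (Metric.measure_ball_pos volume z hr).ne')
    (.inl measure_ball_lt_top.ne)).1 ?_ |>.trans_eq (mul_comm _ _)
  refine le_liminf_of_le (h := ?_)
  filter_upwards [Metric.ball_mem_nhds z hδ] with y hy
  rw [Metric.mem_ball] at hy
  refine le_iInf₂ fun V hV => ENNReal.div_le_of_le_mul' ?_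
  have h1 : Metric.ball z s ⊆ Metric.ball y (s + (r - s) / 3) :=
    Metric.ball_subset_ball' (by rw [dist_comm]; linarith)
  have h2 : Metric.closedBall y (r - (r - s) / 3) ⊆ Ω :=
    (Metric.closedBall_subset_closedBall' (by linarith)).trans hball
  calc ⨅ V ∈ F, ∫⁻ x in Metric.ball z s, V x
      ≤ ∫⁻ x in Metric.ball z s, V x := iInf₂_le V hV
    _ ≤ ∫⁻ x in Metric.ball y (s + (r - s) / 3), V x := lintegral_mono_set h1
    _ ≤ volume (Metric.ball y (r - (r - s) / 3)) * V y :=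
        hF V hV y _ _ (by linarith) (by linarith) h2
    _ ≤ volume (Metric.ball z r) * V y := by
        rw [Measure.addHaar_ball_center volume z, Measure.addHaar_ball_center volume y]
        gcongr
        linarith

lemma superMean_regInf {F : Set ((Fin n → ℂ) → ℝ≥0∞)} (hF : ∀ V ∈ F, SuperMean Ω V) :
    SuperMean Ω (regInf F) := fun _ _ _ hs hsr hball =>
  (le_iInf₂ fun _ hV => lintegral_mono fun x => regInf_le hV x).trans
    (iInf_lintegral_le_regInf hF hs hsr hball)

/-- Subadditivity of regularized lower envelopes of families with the super mean value
property. -/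
lemma lscHull_le_regInf_add_regInf (hΩ : IsOpen Ω) {F G : Set ((Fin n → ℂ) → ℝ≥0∞)}
    (hF : ∀ V ∈ F, SuperMean Ω V) (hG : ∀ V ∈ G, SuperMean Ω V) (hFm : ∀ V ∈ F, Measurable V)
    {c : (Fin n → ℂ) → ℝ≥0∞} (hc : ∀ V ∈ F, ∀ W ∈ G, ∀ z ∈ Ω, c z ≤ V z + W z)
    {z : Fin n → ℂ} (hz : z ∈ Ω) : lscHull c z ≤ regInf F z + regInf G z := by
  refine le_of_forall_lt_imp_le_of_dense fun t ht => ?_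
  obtain ⟨r, hr, hball⟩ := Metric.nhds_basis_closedBall.mem_iff.1
    (inter_mem (hΩ.mem_nhds hz) (eventually_lt_of_lt_liminf ht))
  rw [subset_inter_iff] at hball
  have key : ∀ l : ℝ, 0 < l → l < 1 →
      ENNReal.ofReal (l ^ Module.finrank ℝ (Fin n → ℂ)) * t ≤ regInf F z + regInf G z := by
    intro l hl0 hl1
    have hs : 0 < l * r := by positivity
    have hsr : l * r < r := by nlinarith
    have h1 : t * volume (Metric.ball z (l * r)) ≤
        volume (Metric.ball z r) * regInf F z + volume (Metric.ball z r) * regInf G z := by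
      refine le_trans ?_ (add_le_add (iInf_lintegral_le_regInf hF hs hsr hball.1)
        (iInf_lintegral_le_regInf hG hs hsr hball.1))
      refine ENNReal.le_iInf₂_add_iInf₂ fun V hV W hW => ?_
      rw [← lintegral_add_left (hFm V hV), ← setLIntegral_const]
      refine setLIntegral_mono' Metric.isOpen_ball.measurableSet fun x hx => ?_
      have hx' : x ∈ Metric.closedBall z r :=
        Metric.ball_subset_closedBall (Metric.ball_subset_ball hsr.le hx)
      exact (hball.2 hx').le.trans (hc V hV W hW x (hball.1 hx'))
    rw [Measure.addHaar_ball_mul_of_pos volume z hl0, ← mul_add,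
      Measure.addHaar_ball_center volume z, ← mul_assoc, mul_comm _ (volume _), mul_comm t] at h1
    exact (ENNReal.mul_le_mul_iff_right (Metric.measure_ball_pos volume 0 hr).ne'
      measure_ball_lt_top.ne).1 h1
  have hlim : Tendsto (fun l : ℝ => ENNReal.ofReal (l ^ Module.finrank ℝ (Fin n → ℂ)) * t)
      (𝓝[<] 1) (𝓝 (1 * t)) := by
    refine ENNReal.Tendsto.mul_const ?_ (.inl one_ne_zero)
    have : Continuous fun l : ℝ => ENNReal.ofReal (l ^ Module.finrank ℝ (Fin n → ℂ)) :=
      ENNReal.continuous_ofReal.comp (continuous_pow _)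
    simpa using (this.tendsto 1).mono_left nhdsWithin_le_nhds
  rw [one_mul] at hlim
  refine le_of_tendsto hlim ?_
  filter_upwards [Ioo_mem_nhdsLT (show (0 : ℝ) < 1 by norm_num)] with l hl
  exact key l hl.1 hl.2

/-- The extended nonnegative versions of the plurisuperharmonic majorants of `(f - λ)⁺`. -/
def majorants (Ω : Set (Fin n → ℂ)) (f : (Fin n → ℂ) → EReal) (lam : ℝ) :
    Set ((Fin n → ℂ) → ℝ≥0∞) :=
  {V | ∃ v, IsPSupH Ω v ∧ (∀ ζ ∈ Ω, max (f ζ - (lam : EReal)) 0 ≤ v ζ) ∧ V = toENNRealOn Ω v}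

/-- The regularized reduced functions `S_λ f`, `0 ≤ λ`, as extended nonnegative functions. -/
def regReduced (Ω : Set (Fin n → ℂ)) (f : (Fin n → ℂ) → EReal) :
    Set ((Fin n → ℂ) → ℝ≥0∞) :=
  {V | ∃ lam : ℝ, 0 ≤ lam ∧ V = regInf (majorants Ω f lam)}

lemma monotone_toENNReal : Monotone EReal.toENNReal := fun _ _ h =>
  EReal.toENNReal_le_toENNReal h

lemma toENNReal_iInf {ι : Sort*} (a : ι → EReal) :
    (⨅ i, a i).toENNReal = ⨅ i, (a i).toENNReal :=
  monotone_toENNReal.map_iInf_of_continuousAt EReal.continuous_toENNReal.continuousAt rfl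

lemma toENNReal_Rop (f : (Fin n → ℂ) → EReal) (lam : ℝ) {z : Fin n → ℂ} (hz : z ∈ Ω) :
    (Rop Ω f lam z).toENNReal = ⨅ V ∈ majorants Ω f lam, V z := by
  rw [Rop, monotone_toENNReal.map_sInf_of_continuousAt
    EReal.continuous_toENNReal.continuousAt rfl, sInf_image]
  apply le_antisymm
  · refine le_iInf₂ ?_
    rintro _ ⟨v, hv, hm, rfl⟩
    rw [toENNRealOn_apply hz]
    exact iInf₂_le (v z) ⟨v, hv, hm, rfl⟩
  · refine le_iInf₂ ?_
    rintro _ ⟨v, hv, hm, rfl⟩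
    rw [← toENNRealOn_apply hz (v := v)]
    exact iInf₂_le (toENNRealOn Ω v) ⟨v, hv, hm, rfl⟩

lemma toENNReal_lscReg (hΩ : IsOpen Ω) {a : (Fin n → ℂ) → EReal} {b : (Fin n → ℂ) → ℝ≥0∞}
    (hab : ∀ z ∈ Ω, (a z).toENNReal = b z) {z : Fin n → ℂ} (hz : z ∈ Ω) :
    (lscReg Ω a z).toENNReal = lscHull b z := by
  rw [lscReg, hΩ.nhdsWithin_eq hz,
    monotone_toENNReal.map_liminf_of_continuousAt _ EReal.continuous_toENNReal.continuousAt]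
  exact liminf_congr ((hΩ.eventually_mem hz).mono hab)

lemma toENNReal_Slam (hΩ : IsOpen Ω) (f : (Fin n → ℂ) → EReal) (lam : ℝ) {z : Fin n → ℂ}
    (hz : z ∈ Ω) : (Slam Ω f lam z).toENNReal = regInf (majorants Ω f lam) z :=
  toENNReal_lscReg hΩ (fun _ => toENNReal_Rop f lam) hz

lemma toENNReal_Sop (hΩ : IsOpen Ω) (f : (Fin n → ℂ) → EReal) {z : Fin n → ℂ} (hz : z ∈ Ω) :
    (Sop Ω f z).toENNReal = regInf (regReduced Ω f) z := by
  refine toENNReal_lscReg hΩ (fun y hy => ?_) hz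
  simp only [toENNReal_iInf, toENNReal_Slam hΩ f _ hy]
  apply le_antisymm
  · refine le_iInf₂ ?_
    rintro _ ⟨lam, hlam, rfl⟩
    exact iInf₂_le lam hlam
  · exact le_iInf₂ fun lam hlam => iInf₂_le _ ⟨lam, hlam, rfl⟩

lemma lscReg_nonneg {a : (Fin n → ℂ) → EReal} (ha : ∀ z ∈ Ω, 0 ≤ a z) (z : Fin n → ℂ) :
    0 ≤ lscReg Ω a z :=
  le_liminf_of_le (h := eventually_mem_nhdsWithin.mono ha)

lemma Sop_nonneg (f : (Fin n → ℂ) → EReal) (z : Fin n → ℂ) : 0 ≤ Sop Ω f z := by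
  refine lscReg_nonneg (fun y _ => le_iInf₂ fun lam _ => lscReg_nonneg (fun x hx => ?_) y) z
  refine le_sInf ?_
  rintro _ ⟨v, -, hm, rfl⟩
  exact (le_max_right _ _).trans (hm x hx)

lemma superMean_of_mem_majorants (hΩ : IsOpen Ω) {f : (Fin n → ℂ) → EReal} {lam : ℝ}
    {V : (Fin n → ℂ) → ℝ≥0∞} (hV : V ∈ majorants Ω f lam) : SuperMean Ω V := by
  obtain ⟨v, hv, hm, rfl⟩ := hV
  exact hv.superMean hΩ fun z hz => (le_max_right _ _).trans (hm z hz)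

lemma measurable_of_mem_majorants (hΩ : IsOpen Ω) {f : (Fin n → ℂ) → EReal} {lam : ℝ}
    {V : (Fin n → ℂ) → ℝ≥0∞} (hV : V ∈ majorants Ω f lam) : Measurable V := by
  obtain ⟨v, hv, -, rfl⟩ := hV
  exact (hv.lowerSemicontinuous_toENNRealOn hΩ).measurable

lemma max_add_sub_le {x y : EReal} (hx : 0 ≤ x) (hy : 0 ≤ y) (l m : ℝ) :
    max (x + y - ((l + m : ℝ) : EReal)) 0 ≤
      max (x - (l : EReal)) 0 + max (y - (m : EReal)) 0 := by
  refine max_le ?_ (add_nonneg (le_max_right _ _) (le_max_right _ _))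
  refine le_trans (le_of_eq ?_) (add_le_add (le_max_left _ _) (le_max_left _ _))
  induction x with
  | bot => simp at hx
  | top =>
    induction y with
    | bot => simp at hy
    | top => rfl
    | coe y => rfl
  | coe x =>
    induction y with
    | bot => simp at hy
    | top => rfl
    | coe y => norm_cast; ring

lemma add_mem_majorants (hΩ : IsOpen Ω) (hc : IsConnected Ω) {f g : (Fin n → ℂ) → EReal}
    (hf : ∀ z ∈ Ω, 0 ≤ f z) (hg : ∀ z ∈ Ω, 0 ≤ g z) {l m : ℝ} {V W : (Fin n → ℂ) → ℝ≥0∞}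
    (hV : V ∈ majorants Ω f l) (hW : W ∈ majorants Ω g m) :
    V + W ∈ majorants Ω (fun z => f z + g z) (l + m) := by
  obtain ⟨v, hv, hvm, rfl⟩ := hV
  obtain ⟨w, hw, hwm, rfl⟩ := hW
  have hv0 : ∀ z ∈ Ω, 0 ≤ v z := fun z hz => (le_max_right _ _).trans (hvm z hz)
  have hw0 : ∀ z ∈ Ω, 0 ≤ w z := fun z hz => (le_max_right _ _).trans (hwm z hz)
  refine ⟨fun z => v z + w z, hv.add hΩ hc hw hv0 hw0, fun z hz => ?_, ?_⟩
  · exact (max_add_sub_le (hf z hz) (hg z hz) l m).trans (add_le_add (hvm z hz) (hwm z hz))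
  · ext z
    by_cases hz : z ∈ Ω
    · simp [toENNRealOn_apply hz, EReal.toENNReal_add (hv0 z hz) (hw0 z hz)]
    · simp [toENNRealOn, hz]

lemma regInf_majorants_add_le (hΩ : IsOpen Ω) (hc : IsConnected Ω) {f g : (Fin n → ℂ) → EReal}
    (hf : ∀ z ∈ Ω, 0 ≤ f z) (hg : ∀ z ∈ Ω, 0 ≤ g z) (l m : ℝ) {z : Fin n → ℂ} (hz : z ∈ Ω) :
    regInf (majorants Ω (fun z => f z + g z) (l + m)) z ≤
      regInf (majorants Ω f l) z + regInf (majorants Ω g m) z :=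
  lscHull_le_regInf_add_regInf hΩ (fun _ => superMean_of_mem_majorants hΩ)
    (fun _ => superMean_of_mem_majorants hΩ) (fun _ => measurable_of_mem_majorants hΩ)
    (fun _ hV _ hW _ _ => iInf₂_le _ (add_mem_majorants hΩ hc hf hg hV hW)) hz

lemma regInf_regReduced_add_le (hΩ : IsOpen Ω) (hc : IsConnected Ω)
    {f g : (Fin n → ℂ) → EReal} (hf : ∀ z ∈ Ω, 0 ≤ f z) (hg : ∀ z ∈ Ω, 0 ≤ g z)
    {z : Fin n → ℂ} (hz : z ∈ Ω) :
    regInf (regReduced Ω fun z => f z + g z) z ≤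
      regInf (regReduced Ω f) z + regInf (regReduced Ω g) z := by
  have hmean {f : (Fin n → ℂ) → EReal} : ∀ V ∈ regReduced Ω f, SuperMean Ω V := by
    rintro _ ⟨l, -, rfl⟩
    exact superMean_regInf fun _ => superMean_of_mem_majorants hΩ
  refine lscHull_le_regInf_add_regInf hΩ hmean hmean ?_ ?_ hz
  · rintro _ ⟨l, -, rfl⟩
    exact (lowerSemicontinuous_lscHull _).measurable
  · rintro _ ⟨l, hl, rfl⟩ _ ⟨m, hm, rfl⟩ y hy
    exact (iInf₂_le _ ⟨l + m, add_nonneg hl hm, rfl⟩).trans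
      (regInf_majorants_add_le hΩ hc hf hg l m hy)

end Regularization

/-- Proposition 2.1(2): for a bounded domain `Ω ⊆ ℂⁿ` and `f, g ∈ ℳ`,
one has `S(f + g) ≤ S f + S g` everywhere on `Ω`. -/
theorem statement1 {n : ℕ} (Ω : Set (Fin n → ℂ))
    (hΩo : IsOpen Ω) (hΩc : IsConnected Ω) (hΩb : Bornology.IsBounded Ω)
    (f g : (Fin n → ℂ) → EReal) (hf : MemM Ω f) (hg : MemM Ω g) :
    ∀ z ∈ Ω, Sop Ω (fun ζ => f ζ + g ζ) z ≤ Sop Ω f z + Sop Ω g z := by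
  intro z hz
  rw [← EReal.coe_toENNReal (Sop_nonneg (Ω := Ω) (fun ζ => f ζ + g ζ) z),
    ← EReal.coe_toENNReal (add_nonneg (Sop_nonneg (Ω := Ω) f z) (Sop_nonneg g z)),
    EReal.toENNReal_add (Sop_nonneg f z) (Sop_nonneg g z), toENNReal_Sop hΩo _ hz,
    toENNReal_Sop hΩo _ hz, toENNReal_Sop hΩo _ hz]
  exact_mod_cast regInf_regReduced_add_le hΩo hΩc hf.1 hg.1 hz
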